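/- Let Z be an integrable real-valued random variable and let p ∈ (0,1). Then the superquantile of Z at level p satisfies S̄_p[Z] = inf_{η ∈ ℝ} { η + (1/(1−p))·E[max(Z − η, 0)] }. -/

import Mathlib

open MeasureTheory

/-- The cumulative distribution function `F_Z(t) = P(Z ≤ t)` of a random variable `Z`. -/
noncomputable def cdfRV {Ω : Type*} [MeasurableSpace Ω] (μ : Measure Ω) (Z : Ω → ℝ) (t : ℝ) : ℝ :=
  (μ {ω | Z ω ≤ t}).toReal

/-- The quantile function `Q_Z(u) = inf {t : F_Z(t) ≥ u}` of a random variable `Z`. -/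
noncomputable def quantileRV {Ω : Type*} [MeasurableSpace Ω] (μ : Measure Ω) (Z : Ω → ℝ)
    (u : ℝ) : ℝ :=
  sInf {t : ℝ | u ≤ cdfRV μ Z t}

lemma sq_cdf_eq {Ω : Type*} [MeasurableSpace Ω] (μ : Measure Ω)
    [IsProbabilityMeasure μ] (Z : Ω → ℝ) (hZ : Measurable Z) (t : ℝ) :
    cdfRV μ Z t = ProbabilityTheory.cdf (μ.map Z) t := by
  have : IsProbabilityMeasure (μ.map Z) := Measure.isProbabilityMeasure_map hZ.aemeasurable
  rw [ProbabilityTheory.cdf_eq_real, Measure.real, Measure.map_apply hZ measurableSet_Iic]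
  rfl

lemma sq_galois {Ω : Type*} [MeasurableSpace Ω] (μ : Measure Ω)
    [IsProbabilityMeasure μ] (Z : Ω → ℝ) (hZ : Measurable Z) {u : ℝ}
    (hu : u ∈ Set.Ioo (0 : ℝ) 1) (t : ℝ) :
    quantileRV μ Z u ≤ t ↔ u ≤ cdfRV μ Z t := by
  have : IsProbabilityMeasure (μ.map Z) := Measure.isProbabilityMeasure_map hZ.aemeasurable
  unfold quantileRV
  simp only [sq_cdf_eq μ Z hZ]
  set G := ProbabilityTheory.cdf (μ.map Z) with hG
  have hbot := (ProbabilityTheory.tendsto_cdf_atBot (μ.map Z)).eventually (gt_mem_nhds hu.1)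
  have htop := (ProbabilityTheory.tendsto_cdf_atTop (μ.map Z)).eventually (lt_mem_nhds hu.2)
  have hmono : Monotone G := ProbabilityTheory.monotone_cdf _
  constructor
  · intro h
    obtain ⟨b, hb⟩ := htop.exists
    have hne : {t : ℝ | u ≤ G t}.Nonempty := ⟨b, hb.le⟩
    have hc : Filter.Tendsto G (nhdsWithin t (Set.Ioi t)) (nhds (G t)) :=
      ((G.right_continuous t).mono Set.Ioi_subset_Ici_self)
    refine ge_of_tendsto hc ?_
    filter_upwards [self_mem_nhdsWithin] with s hs
    obtain ⟨r, hr, hrs⟩ := exists_lt_of_csInf_lt hne (lt_of_le_of_lt h hs)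
    exact le_trans hr (hmono hrs.le)
  · intro h
    obtain ⟨a, ha⟩ := hbot.exists
    refine csInf_le ⟨a, ?_⟩ h
    intro r hr
    by_contra hlt
    push Not at hlt
    exact absurd (lt_of_le_of_lt (le_trans hr (hmono hlt.le)) ha) (lt_irrefl _)

lemma sq_mono {Ω : Type*} [MeasurableSpace Ω] (μ : Measure Ω)
    [IsProbabilityMeasure μ] (Z : Ω → ℝ) (hZ : Measurable Z) :
    MonotoneOn (quantileRV μ Z) (Set.Ioo 0 1) := by
  intro u hu v hv huv
  rw [sq_galois μ Z hZ hu]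
  exact le_trans huv ((sq_galois μ Z hZ hv _).1 le_rfl)

lemma sq_aem {Ω : Type*} [MeasurableSpace Ω] (μ : Measure Ω)
    [IsProbabilityMeasure μ] (Z : Ω → ℝ) (hZ : Measurable Z) :
    AEMeasurable (quantileRV μ Z) (volume.restrict (Set.Ioo 0 1)) :=
  aemeasurable_restrict_of_monotoneOn measurableSet_Ioo (sq_mono μ Z hZ)

lemma sq_map {Ω : Type*} [MeasurableSpace Ω] (μ : Measure Ω)
    [IsProbabilityMeasure μ] (Z : Ω → ℝ) (hZ : Measurable Z) :
    (volume.restrict (Set.Ioo (0:ℝ) 1)).map (quantileRV μ Z) = μ.map Z := by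
  have := Measure.isProbabilityMeasure_map (μ := μ) hZ.aemeasurable
  refine (Measure.ext_of_Iic _ _ fun t => ?_)
  rw [Measure.map_apply_of_aemeasurable (sq_aem μ Z hZ) measurableSet_Iic,
    Measure.map_apply hZ measurableSet_Iic]
  have h1 : (quantileRV μ Z ⁻¹' Set.Iic t) =ᵐ[volume.restrict (Set.Ioo (0:ℝ) 1)]
      Set.Iic (cdfRV μ Z t) := by
    filter_upwards [ae_restrict_mem measurableSet_Ioo] with u hu
    exact propext (sq_galois μ Z hZ hu t)
  rw [measure_congr h1, restrict_Ioo_eq_restrict_Ioc, Measure.restrict_apply measurableSet_Iic]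
  have hle : cdfRV μ Z t ≤ 1 := by
    rw [sq_cdf_eq μ Z hZ]; exact ProbabilityTheory.cdf_le_one _ _
  have h2 : Set.Iic (cdfRV μ Z t) ∩ Set.Ioc 0 1 = Set.Ioc 0 (cdfRV μ Z t) := by
    ext x; simp only [Set.mem_inter_iff, Set.mem_Iic, Set.mem_Ioc]
    constructor
    · rintro ⟨a, b, c⟩; exact ⟨b, a⟩
    · rintro ⟨a, b⟩; exact ⟨b, a, b.trans hle⟩
  rw [h2, Real.volume_Ioc, sub_zero, cdfRV, ENNReal.ofReal_toReal (measure_ne_top _ _)]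
  rfl

theorem superquantile_characterization {Ω : Type*} [MeasurableSpace Ω] (μ : Measure Ω)
    [IsProbabilityMeasure μ] (Z : Ω → ℝ) (hZ : Measurable Z) (hZint : Integrable Z μ)
    (p : ℝ) (hp : p ∈ Set.Ioo (0 : ℝ) 1) :
    (1 / (1 - p)) * ∫ u in p..(1 : ℝ), quantileRV μ Z u =
      ⨅ η : ℝ, (η + (1 / (1 - p)) * ∫ ω, max (Z ω - η) 0 ∂μ) := by
  have hq : 0 < 1 - p := by linarith [hp.2]
  have hQ : IntegrableOn (quantileRV μ Z) (Set.Ioo 0 1) := by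
    have h1 : Integrable (id : ℝ → ℝ) (μ.map Z) :=
      (integrable_map_measure aestronglyMeasurable_id hZ.aemeasurable).2 hZint
    rw [← sq_map μ Z hZ] at h1
    exact (integrable_map_measure aestronglyMeasurable_id (sq_aem μ Z hZ)).1 h1
  have hcont : ∀ η : ℝ, Continuous fun x : ℝ => max (x - η) 0 := fun η => by fun_prop
  have hE : ∀ η : ℝ, ∫ ω, max (Z ω - η) 0 ∂μ
      = ∫ u in Set.Ioo (0:ℝ) 1, max (quantileRV μ Z u - η) 0 := by
    intro η
    rw [← integral_map (f := fun x : ℝ => max (x - η) 0) hZ.aemeasurable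
      (hcont η).aestronglyMeasurable, ← sq_map μ Z hZ,
      integral_map (sq_aem μ Z hZ) (hcont η).aestronglyMeasurable]
  have hM : ∀ η : ℝ, IntegrableOn (fun u => max (quantileRV μ Z u - η) 0) (Set.Ioo 0 1) :=
    fun η => (hQ.sub (integrable_const η)).pos_part
  have hsub : Set.Ioo p 1 ⊆ Set.Ioo (0:ℝ) 1 := Set.Ioo_subset_Ioo_left hp.1.le
  have hI : ∫ u in p..(1 : ℝ), quantileRV μ Z u = ∫ u in Set.Ioo p 1, quantileRV μ Z u := by
    rw [intervalIntegral.integral_of_le hp.2.le, restrict_Ioo_eq_restrict_Ioc]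
  have hdiff : ∀ η : ℝ, ∫ u in Set.Ioo p 1, (quantileRV μ Z u - η)
      = (∫ u in Set.Ioo p 1, quantileRV μ Z u) - (1 - p) * η := by
    intro η
    rw [integral_sub (hQ.mono_set hsub) (integrable_const η)]
    simp [hq.le]
  rw [hI]
  set I := ∫ u in Set.Ioo p 1, quantileRV μ Z u with hIdef
  have hlow : ∀ η : ℝ, (1 / (1 - p)) * I ≤ η + (1 / (1 - p)) * ∫ ω, max (Z ω - η) 0 ∂μ := by
    intro η
    have h1 : I - (1 - p) * η ≤ ∫ ω, max (Z ω - η) 0 ∂μ := by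
      rw [← hdiff, hE]
      refine le_trans (integral_mono ((hQ.mono_set hsub).sub (integrable_const η))
        ((hM η).mono_set hsub) (fun u => le_max_left _ _)) ?_
      exact setIntegral_mono_set (hM η) (Filter.Eventually.of_forall fun u => le_max_right _ _)
        hsub.eventuallyLE
    have h2 := mul_le_mul_of_nonneg_left h1 (one_div_pos.2 hq).le
    have h3 : 1 / (1 - p) * (I - (1 - p) * η) = 1 / (1 - p) * I - η := by field_simp
    linarith
  have heq : (quantileRV μ Z p) + (1 / (1 - p)) * ∫ ω, max (Z ω - quantileRV μ Z p) 0 ∂μ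
      = (1 / (1 - p)) * I := by
    have h1 : ∫ ω, max (Z ω - quantileRV μ Z p) 0 ∂μ = I - (1 - p) * quantileRV μ Z p := by
      rw [← hdiff, hE]
      rw [setIntegral_eq_of_subset_of_forall_diff_eq_zero measurableSet_Ioo hsub]
      · refine setIntegral_congr_fun measurableSet_Ioo fun u hu => ?_
        exact max_eq_left (sub_nonneg.2 (sq_mono μ Z hZ hp (hsub hu) hu.1.le))
      · intro u hu
        have hup : u ≤ p := by
          by_contra h
          exact hu.2 ⟨not_le.1 h, hu.1.2⟩
        exact max_eq_right (sub_nonpos.2 (sq_mono μ Z hZ hu.1 hp hup))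
    rw [h1]; field_simp; ring
  apply le_antisymm (le_ciInf hlow)
  rw [← heq]
  exact ciInf_le (f := fun η : ℝ => η + (1 / (1 - p)) * ∫ ω, max (Z ω - η) 0 ∂μ)
    ⟨_, by rintro _ ⟨η, rfl⟩; exact hlow η⟩ _
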